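/- arXiv:2010.08007 — 2 statements merged into one kernel-verified Lean document; each statement's English description precedes it below -/
import Mathlib

section
/- Let 𝒳 be a set, T ∈ ℕ, and let Θ be a finite set of functions f : 𝒳 → ℝ with pairwise disjoint supports, such that |Θ| ≥ 2T and every f ∈ Θ satisfies sup_{x ∈ 𝒳} f(x) ≥ M for some M > 0. Let (Ω, ℱ, P) be a probability space modeling algorithmic randomness, and for each f ∈ Θ let X_1^f, …, X_T^f : Ω → 𝒳 be defined recursively by maps x̂_{t+1} : Ω × 𝒳^t × ℝ^t → 𝒳 via X_{t+1}^f(ω) = x̂_{t+1}(ω, X_1^f(ω), …, X_t^f(ω), f(X_1^f(ω)), …, f(X_t^f(ω))) (with X_1^f(ω) = x̂_1(ω)). Then there exists f ∈ Θ such that P( f(X_1^f) = ⋯ = f(X_T^f) = 0 ) ≥ (|Θ| − T)/|Θ| ≥ 1/2, and consequently E[ sup_{x ∈ 𝒳} f(x) − f(X_T^f) ] ≥ M/2. -/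
open MeasureTheory

/-- Abstract noiseless lower bound. Let `Θ` be a finite family of objective
functions with pairwise disjoint supports, `|Θ| ≥ 2T`, each with supremum at least `M > 0`.
For each `f ∈ Θ`, the query sequence `Q f 0, …, Q f (T-1)` is produced by a sequential
strategy `x̂` from algorithmic randomness `ω` and previously observed noiseless values.
Then some `f ∈ Θ` is completely missed with probability at least `(|Θ| - T)/|Θ| ≥ 1/2`,
so the expected simple regret on `f` is at least `M/2`. -/
theorem stmt9 {𝒳 : Type*} {Ω : Type*} [MeasurableSpace Ω]
    (P : Measure Ω) [IsProbabilityMeasure P]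
    (T : ℕ) (hT : 1 ≤ T)
    (Θ : Finset (𝒳 → ℝ))
    (hdisj : ∀ f ∈ Θ, ∀ g ∈ Θ, f ≠ g → ∀ x, f x = 0 ∨ g x = 0)
    (hcard : 2 * T ≤ Θ.card)
    (M : ℝ) (hM : 0 < M)
    (hbdd : ∀ f ∈ Θ, BddAbove (Set.range f))
    (hsup : ∀ f ∈ Θ, M ≤ ⨆ x, f x)
    (xhat : (t : ℕ) → Ω → (Fin t → 𝒳) → (Fin t → ℝ) → 𝒳)
    (Q : (𝒳 → ℝ) → ℕ → Ω → 𝒳)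
    (hrec : ∀ f ∈ Θ, ∀ (t : ℕ) (ω : Ω),
      Q f t ω = xhat t ω (fun s : Fin t => Q f s ω) (fun s : Fin t => f (Q f s ω)))
    (hmeas : ∀ f ∈ Θ, ∀ t : ℕ, Measurable fun ω => f (Q f t ω))
    (hint : ∀ f ∈ Θ, Integrable (fun ω => (⨆ x, f x) - f (Q f (T - 1) ω)) P) :
    ∃ f ∈ Θ,
      ((Θ.card : ℝ) - T) / Θ.card ≤ (P {ω | ∀ t < T, f (Q f t ω) = 0}).toReal ∧
      (1 : ℝ) / 2 ≤ (P {ω | ∀ t < T, f (Q f t ω) = 0}).toReal ∧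
      M / 2 ≤ ∫ ω, ((⨆ x, f x) - f (Q f (T - 1) ω)) ∂P := by
  classical
  -- `B f t`: the first nonzero observation on `f` occurs at time `t`
  let B : (𝒳 → ℝ) → ℕ → Set Ω := fun f t =>
    {ω | f (Q f t ω) ≠ 0 ∧ ∀ s < t, f (Q f s ω) = 0}
  let A : (𝒳 → ℝ) → Set Ω := fun f => {ω | ∀ t < T, f (Q f t ω) = 0}
  have hz : ∀ f ∈ Θ, ∀ t, MeasurableSet {ω | f (Q f t ω) = 0} := fun f hf t =>
    hmeas f hf t (measurableSet_singleton 0)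
  have hA : ∀ f ∈ Θ, MeasurableSet (A f) := by
    intro f hf
    have : A f = ⋂ t, ⋂ (_ : t < T), {ω | f (Q f t ω) = 0} := by
      ext ω; simp [A]
    rw [this]
    exact MeasurableSet.iInter fun t => MeasurableSet.iInter fun _ => hz f hf t
  have hB : ∀ f ∈ Θ, ∀ t, MeasurableSet (B f t) := by
    intro f hf t
    have : B f t = {ω | f (Q f t ω) = 0}ᶜ ∩ ⋂ s, ⋂ (_ : s < t), {ω | f (Q f s ω) = 0} := by
      ext ω; simp [B]
    rw [this]
    exact (hz f hf t).compl.inter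
      (MeasurableSet.iInter fun s => MeasurableSet.iInter fun _ => hz f hf s)
  have hagree : ∀ f ∈ Θ, ∀ g ∈ Θ, ∀ ω, ∀ t, (∀ s < t, f (Q f s ω) = 0) →
      (∀ s < t, g (Q g s ω) = 0) → Q f t ω = Q g t ω := by
    intro f hf g hg ω t
    induction t using Nat.strong_induction_on with
    | _ t ih =>
      intro h1 h2
      rw [hrec f hf, hrec g hg]
      congr 1
      · funext s
        exact ih s s.2 (fun r hr => h1 r (hr.trans s.2)) (fun r hr => h2 r (hr.trans s.2))
      · funext s
        rw [h1 s s.2, h2 s s.2]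
  have hBdisj : ∀ t, ∀ f ∈ Θ, ∀ g ∈ Θ, f ≠ g → Disjoint (B f t) (B g t) := by
    intro t f hf g hg hfg
    rw [Set.disjoint_left]
    rintro ω ⟨h1, h2⟩ ⟨h3, h4⟩
    have e := hagree f hf g hg ω t h2 h4
    rcases hdisj f hf g hg hfg (Q f t ω) with h | h
    · exact h1 h
    · rw [e] at h
      exact h3 h
  have hsumt : ∀ t, ∑ f ∈ Θ, P.real (B f t) ≤ 1 := by
    intro t
    rw [← measureReal_biUnion_finset (fun f hf g hg hfg => hBdisj t f hf g hg hfg)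
      (fun f hf => hB f hf t)]
    exact measureReal_le_one
  have hcov : ∀ f ∈ Θ, 1 - P.real (A f) ≤ ∑ t ∈ Finset.range T, P.real (B f t) := by
    intro f hf
    rw [← probReal_compl_eq_one_sub (hA f hf)]
    refine le_trans (measureReal_mono ?_ (measure_ne_top _ _))
      (measureReal_biUnion_finset_le (Finset.range T) (B f))
    intro ω hω
    have hex : ∃ t, t < T ∧ f (Q f t ω) ≠ 0 := by
      by_contra! hcon
      exact hω hcon
    have hsp := Nat.find_spec hex
    simp only [Set.mem_iUnion, Finset.mem_range]
    refine ⟨Nat.find hex, hsp.1, hsp.2, fun s hs => ?_⟩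
    have := Nat.find_min hex hs
    by_contra h
    exact this ⟨hs.trans hsp.1, h⟩
  have htot : ∑ f ∈ Θ, (1 - P.real (A f)) ≤ T := by
    calc ∑ f ∈ Θ, (1 - P.real (A f)) ≤ ∑ f ∈ Θ, ∑ t ∈ Finset.range T, P.real (B f t) :=
          Finset.sum_le_sum hcov
      _ = ∑ t ∈ Finset.range T, ∑ f ∈ Θ, P.real (B f t) := Finset.sum_comm
      _ ≤ ∑ t ∈ Finset.range T, (1 : ℝ) := Finset.sum_le_sum fun t _ => hsumt t
      _ = T := by simp
  have hpos : 0 < Θ.card := by omega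
  have hposR : (0 : ℝ) < Θ.card := by exact_mod_cast hpos
  have hcardR : 2 * (T : ℝ) ≤ Θ.card := by exact_mod_cast hcard
  obtain ⟨f, hf, hle⟩ : ∃ f ∈ Θ, 1 - P.real (A f) ≤ (T : ℝ) / Θ.card := by
    apply Finset.exists_le_of_sum_le (Finset.card_pos.mp hpos)
    rw [Finset.sum_const, nsmul_eq_mul, mul_div_cancel₀ _ hposR.ne']
    exact htot
  have h1 : ((Θ.card : ℝ) - T) / Θ.card ≤ P.real (A f) := by
    rw [sub_div, div_self hposR.ne']
    linarith
  have h2 : (1 : ℝ) / 2 ≤ P.real (A f) := by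
    refine le_trans ?_ h1
    rw [div_le_div_iff₀ two_pos hposR]
    linarith
  refine ⟨f, hf, h1, h2, ?_⟩
  calc M / 2 ≤ P.real (A f) * M := by nlinarith
    _ = ∫ ω, (A f).indicator (fun _ => M) ω ∂P := by
        rw [integral_indicator_const _ (hA f hf), smul_eq_mul]
    _ ≤ _ := by
        refine integral_mono ((integrable_const M).indicator (hA f hf)) (hint f hf) ?_
        intro ω
        by_cases hω : ω ∈ A f
        · have h0 : f (Q f (T - 1) ω) = 0 := hω (T - 1) (by omega)
          simp only [Set.indicator_of_mem hω, h0, sub_zero]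
          exact hsup f hf
        · simp only [Set.indicator_of_notMem hω]
          exact sub_nonneg.mpr (le_ciSup (hbdd f hf) _)
end

section
/- (Theorem 2, noiseless simple-regret lower bound.) Fix d ≥ 1, p ≥ 1, σ > d/p, L > 0. Let φ : ℝ^d → ℝ be bounded with support contained in (0,1)^d and φ* := sup_x φ(x) > 0. For T ∈ ℕ with T ≥ 1, set j := ⌈(1/d) log₂(2T)⌉ and define, for λ ∈ {0,…,2^j−1}^d, f_λ(x) := L·2^{−j(σ + d(1/2 − 1/p))}·2^{dj/2} φ(2^j x − λ) for x ∈ [0,1]^d. Then for any probability space (Ω, ℱ, P) and any sequential strategy (X_1^f, …, X_T^f) defined recursively from maps x̂_{t+1} : Ω × ([0,1]^d)^t × ℝ^t → [0,1]^d as X_{t+1}^f(ω) = x̂_{t+1}(ω, X_{≤t}^f(ω), f(X_1^f(ω)),…,f(X_t^f(ω))), there exists λ such that E[ sup_{x ∈ [0,1]^d} f_λ(x) − f_λ(X_T^{f_λ}) ] ≥ 2^{−(d+1)} · L φ* · 2^{(d+1)(1/p − σ/d)} · T^{1/p − σ/d}. -/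
open MeasureTheory

/-- The rescaled dyadic wavelet bump `f_λ = L 2^{-j(σ + d(1/2 - 1/p))} φ_{j,λ}`,
where `φ_{j,λ}(x) = 2^{dj/2} φ(2^j x - λ)`. -/
noncomputable def bumpFn (d j : ℕ) (L σ p : ℝ) (φ : (Fin d → ℝ) → ℝ)
    (lam : Fin d → ℕ) : (Fin d → ℝ) → ℝ :=
  fun x => L * (2 : ℝ) ^ (-(j : ℝ) * (σ + d * (1 / 2 - 1 / p))) *
    ((2 : ℝ) ^ (((d * j : ℕ) : ℝ) / 2) * φ fun i => (2 : ℝ) ^ j * x i - (lam i : ℝ))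

/-- The query sequence obtained when all observations are zero. -/
noncomputable def zeroSeq {E : Type*} (xh : (t : ℕ) → (Fin t → E) → E) : ℕ → E
  | t => xh t (fun s : Fin t => zeroSeq xh s.1)
  termination_by t => t
  decreasing_by exact s.2

lemma zeroSeq_eq {E : Type*} (xh : (t : ℕ) → (Fin t → E) → E) (t : ℕ) :
    zeroSeq xh t = xh t (fun s : Fin t => zeroSeq xh s.1) := by
  rw [zeroSeq]

lemma follow_zero {E : Type*} (xh : (t : ℕ) → (Fin t → E) → (Fin t → ℝ) → E) (f : E → ℝ)
    (q : ℕ → E) (hq : ∀ t, q t = xh t (fun s : Fin t => q s) (fun s : Fin t => f (q s)))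
    (T : ℕ) (hz : ∀ s < T, f (zeroSeq (fun t xs => xh t xs (fun _ => 0)) s) = 0) :
    ∀ t, t < T → q t = zeroSeq (fun t xs => xh t xs (fun _ => 0)) t := by
  intro t
  induction t using Nat.strong_induction_on with
  | _ t ih =>
    intro ht
    have h1 : (fun s : Fin t => q s)
        = fun s : Fin t => zeroSeq (fun t xs => xh t xs (fun _ => 0)) s.1 := by
      funext s
      exact ih s s.2 (s.2.trans ht)
    have h2 : (fun s : Fin t => f (q s)) = fun _ => 0 := by
      funext s
      rw [ih s s.2 (s.2.trans ht)]
      exact hz s (s.2.trans ht)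
    rw [hq t, h1, h2, zeroSeq_eq]

/-- Amplitude of the bumps. -/
noncomputable def amp (d j : ℕ) (L σ p : ℝ) : ℝ :=
  L * (2 : ℝ) ^ (-(j : ℝ) * (σ + d * (1 / 2 - 1 / p))) * (2 : ℝ) ^ (((d * j : ℕ) : ℝ) / 2)

lemma bumpFn_eq (d j : ℕ) (L σ p : ℝ) (φ : (Fin d → ℝ) → ℝ) (lam : Fin d → ℕ)
    (x : Fin d → ℝ) : bumpFn d j L σ p φ lam x
      = amp d j L σ p * φ fun i => (2 : ℝ) ^ j * x i - (lam i : ℝ) := by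
  unfold bumpFn amp; ring

lemma amp_eq (d j : ℕ) (hd : 1 ≤ d) (L σ p : ℝ) :
    amp d j L σ p = L * (2 : ℝ) ^ (((d : ℝ) * j) * (1 / p - σ / d)) := by
  have hd' : (d : ℝ) ≠ 0 := by positivity
  unfold amp
  rw [mul_assoc, ← Real.rpow_add (by norm_num)]
  congr 2
  push_cast
  field_simp
  ring

lemma abstract_avg {Ω : Type*} [MeasurableSpace Ω] (P : Measure Ω) [IsProbabilityMeasure P]
    {K : Type*} [Fintype K] [Nonempty K] (r : K → Ω → ℝ) (hint : ∀ k, Integrable (r k) P) (c : ℝ)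
    (h : ∀ ω, Fintype.card K * c ≤ ∑ k, r k ω) : ∃ k, c ≤ ∫ ω, r k ω ∂P := by
  by_contra! hc
  have h1 : ∑ k, ∫ ω, r k ω ∂P < ∑ _k : K, c :=
    Finset.sum_lt_sum_of_nonempty Finset.univ_nonempty (fun k _ => hc k)
  rw [← integral_finsetSum _ (fun k _ => hint k)] at h1
  have h2 : ∫ _ω, (Fintype.card K * c : ℝ) ∂P ≤ ∫ ω, ∑ k, r k ω ∂P :=
    integral_mono (integrable_const _) (integrable_finsetSum _ (fun k _ => hint k)) h
  simp at h1 h2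
  linarith

lemma bump_disjoint (d j : ℕ) (L σ p : ℝ) (φ : (Fin d → ℝ) → ℝ)
    (hsupp : Function.support φ ⊆ {u : Fin d → ℝ | ∀ i, u i ∈ Set.Ioo (0 : ℝ) 1})
    (l m : Fin d → ℕ) (x : Fin d → ℝ) (hl : bumpFn d j L σ p φ l x ≠ 0)
    (hm : bumpFn d j L σ p φ m x ≠ 0) : l = m := by
  rw [bumpFn_eq] at hl hm
  have h1 := hsupp (Function.mem_support.2 (right_ne_zero_of_mul hl))
  have h2 := hsupp (Function.mem_support.2 (right_ne_zero_of_mul hm))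
  funext i
  obtain ⟨a, b⟩ := h1 i
  obtain ⟨a', b'⟩ := h2 i
  have e1 : (l i : ℝ) < m i + 1 := by linarith
  have e2 : (m i : ℝ) < l i + 1 := by linarith
  norm_cast at e1 e2
  omega

lemma sup_ge (d j : ℕ) (L σ p : ℝ) (φ : (Fin d → ℝ) → ℝ) (C : ℝ) (hbd : ∀ x, |φ x| ≤ C)
    (hsupp : Function.support φ ⊆ {u : Fin d → ℝ | ∀ i, u i ∈ Set.Ioo (0 : ℝ) 1})
    (hpos : 0 < ⨆ x, φ x) (hA : 0 < amp d j L σ p) (lam : Fin d → ℕ) (hlam : ∀ i, lam i < 2 ^ j) :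
    amp d j L σ p * (⨆ x, φ x)
      ≤ ⨆ x ∈ Set.Icc (0 : Fin d → ℝ) 1, bumpFn d j L σ p φ lam x := by
  have hC : 0 ≤ C := (abs_nonneg _).trans (hbd 0)
  have hle : ∀ x, bumpFn d j L σ p φ lam x ≤ amp d j L σ p * C := fun x => by
    rw [bumpFn_eq]
    exact mul_le_mul_of_nonneg_left ((le_abs_self _).trans (hbd _)) hA.le
  have hin : ∀ x, (⨆ (_ : x ∈ Set.Icc (0 : Fin d → ℝ) 1), bumpFn d j L σ p φ lam x)
      ≤ amp d j L σ p * C := fun x =>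
    Real.iSup_le (fun _ => hle x) (by positivity)
  have hbdd : BddAbove (Set.range fun x : Fin d → ℝ =>
      ⨆ (_ : x ∈ Set.Icc (0 : Fin d → ℝ) 1), bumpFn d j L σ p φ lam x) :=
    ⟨_, by rintro _ ⟨x, rfl⟩; exact hin x⟩
  have key : ∀ x ∈ Set.Icc (0 : Fin d → ℝ) 1, bumpFn d j L σ p φ lam x ≤
      ⨆ x ∈ Set.Icc (0 : Fin d → ℝ) 1, bumpFn d j L σ p φ lam x := fun x hx => by
    refine le_trans ?_ (le_ciSup hbdd x)
    exact (ciSup_pos (f := fun _ => bumpFn d j L σ p φ lam x) hx).ge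
  have hpt : ∀ u, 0 < φ u → amp d j L σ p * φ u ≤
      ⨆ x ∈ Set.Icc (0 : Fin d → ℝ) 1, bumpFn d j L σ p φ lam x := fun u hu => by
    have hu' := hsupp (Function.mem_support.2 hu.ne')
    have h2 : (0 : ℝ) < 2 ^ j := by positivity
    have := key (fun i => (u i + lam i) / 2 ^ j) (by
      constructor
      · intro i
        have := (hu' i).1
        simp only [Pi.zero_apply]
        positivity
      · intro i
        have := (hu' i).2
        have h3 : (lam i : ℝ) + 1 ≤ 2 ^ j := by exact_mod_cast hlam i
        simp only [Pi.one_apply]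
        rw [div_le_one h2]
        linarith)
    rw [bumpFn_eq] at this
    convert this using 3
    funext i
    field_simp
    ring
  rw [← le_div_iff₀' hA]
  obtain ⟨u0, hu0⟩ : ∃ u, 0 < φ u := by
    by_contra! h
    exact absurd (Real.iSup_nonpos h) (not_le.2 hpos)
  refine ciSup_le fun u => ?_
  have h0 : ∀ u, 0 < φ u → φ u ≤ (⨆ x ∈ Set.Icc (0 : Fin d → ℝ) 1,
      bumpFn d j L σ p φ lam x) / amp d j L σ p := fun u hu => by
    rw [le_div_iff₀' hA]; exact hpt u hu
  by_cases hu : 0 < φ u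
  · exact h0 u hu
  · exact (not_lt.1 hu).trans (hu0.le.trans (h0 u0 hu0))

lemma arith_bounds (d : ℕ) (hd : 1 ≤ d) (T : ℕ) (hT : 1 ≤ T) (j : ℕ)
    (hj : j = ⌈Real.logb 2 (2 * T) / d⌉₊) :
    2 * T ≤ (2 ^ j) ^ d ∧ (2 : ℝ) ^ ((d : ℝ) * j) ≤ 2 ^ ((d : ℝ) + 1) * T := by
  have hd' : (0 : ℝ) < d := by positivity
  have hT' : (1 : ℝ) ≤ T := by exact_mod_cast hT
  have h0 : 0 ≤ Real.logb 2 (2 * T) := Real.logb_nonneg (by norm_num) (by linarith)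
  have h1 : Real.logb 2 (2 * T) / d ≤ j := by rw [hj]; exact Nat.le_ceil _
  have h2 : (j : ℝ) < Real.logb 2 (2 * T) / d + 1 := by
    rw [hj]; exact Nat.ceil_lt_add_one (by positivity)
  have hlog : (2 : ℝ) ^ Real.logb 2 (2 * T) = 2 * T :=
    Real.rpow_logb (by norm_num) (by norm_num) (by positivity)
  constructor
  · rw [div_le_iff₀ hd'] at h1
    have : (2 : ℝ) * T ≤ 2 ^ ((j : ℝ) * d) := by
      rw [← hlog]
      exact Real.rpow_le_rpow_of_exponent_le (by norm_num) h1
    rw [Real.rpow_mul (by norm_num), Real.rpow_natCast, Real.rpow_natCast] at this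
    exact_mod_cast this
  · have h3 : (d : ℝ) * j ≤ Real.logb 2 (2 * T) + d := by
      have := mul_lt_mul_of_pos_left h2 hd'
      rw [mul_add, mul_div_cancel₀ _ hd'.ne'] at this
      linarith
    calc (2 : ℝ) ^ ((d : ℝ) * j) ≤ 2 ^ (Real.logb 2 (2 * T) + d) :=
          Real.rpow_le_rpow_of_exponent_le (by norm_num) h3
      _ = 2 ^ ((d : ℝ) + 1) * T := by
          rw [Real.rpow_add (by norm_num), hlog, Real.rpow_add (by norm_num), Real.rpow_one]
          ring

/-- **Theorem 2, noiseless simple-regret lower bound.** For `σ > d/p` and the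
family `{f_λ}` of rescaled wavelets at resolution `j = ⌈(1/d) log₂(2T)⌉`, any sequential
noiseless strategy with horizon `T` (queries in `[0,1]^d`, chosen from algorithmic randomness
and past observations) suffers, on some `f_λ`, expected simple regret at least
`2^{-(d+1)} L φ* 2^{(d+1)(1/p - σ/d)} T^{1/p - σ/d}`. -/
theorem stmt10 (d : ℕ) (hd : 1 ≤ d) (p σ L : ℝ) (hp : 1 ≤ p) (hσ : (d : ℝ) / p < σ)
    (hL : 0 < L)
    (φ : (Fin d → ℝ) → ℝ) (C : ℝ) (hbd : ∀ x, |φ x| ≤ C)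
    (hsupp : Function.support φ ⊆ {u : Fin d → ℝ | ∀ i, u i ∈ Set.Ioo (0 : ℝ) 1})
    (hpos : 0 < ⨆ x, φ x)
    (T : ℕ) (hT : 1 ≤ T)
    (j : ℕ) (hj : j = ⌈Real.logb 2 (2 * T) / d⌉₊)
    {Ω : Type*} [MeasurableSpace Ω] (P : Measure Ω) [IsProbabilityMeasure P]
    (xhat : (t : ℕ) → Ω → (Fin t → (Fin d → ℝ)) → (Fin t → ℝ) → (Fin d → ℝ))
    (hxcube : ∀ (t : ℕ) (ω : Ω) (xs : Fin t → (Fin d → ℝ)) (ys : Fin t → ℝ),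
      xhat t ω xs ys ∈ Set.Icc (0 : Fin d → ℝ) 1)
    (Q : (Fin d → ℕ) → ℕ → Ω → (Fin d → ℝ))
    (hrec : ∀ (lam : Fin d → ℕ), (∀ i, lam i < 2 ^ j) → ∀ (t : ℕ) (ω : Ω),
      Q lam t ω = xhat t ω (fun s : Fin t => Q lam s ω)
        (fun s : Fin t => bumpFn d j L σ p φ lam (Q lam s ω)))
    (hmeas : ∀ (lam : Fin d → ℕ) (t : ℕ),
      Measurable fun ω => bumpFn d j L σ p φ lam (Q lam t ω)) :
    ∃ lam : Fin d → ℕ, (∀ i, lam i < 2 ^ j) ∧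
      (2 : ℝ) ^ (-((d : ℝ) + 1)) * L * (⨆ x, φ x) *
          (2 : ℝ) ^ (((d : ℝ) + 1) * (1 / p - σ / d)) * (T : ℝ) ^ ((1 : ℝ) / p - σ / d)
        ≤ ∫ ω, ((⨆ x ∈ Set.Icc (0 : Fin d → ℝ) 1, bumpFn d j L σ p φ lam x)
            - bumpFn d j L σ p φ lam (Q lam (T - 1) ω)) ∂P := by
  classical
  obtain ⟨hN, hup⟩ := arith_bounds d hd T hT j hj
  have hd' : (0 : ℝ) < d := by positivity
  have hp' : (0 : ℝ) < p := by linarith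
  have hT' : (0 : ℝ) < T := by exact_mod_cast hT
  have hA : 0 < amp d j L σ p := by unfold amp; positivity
  have hexp : 1 / p - σ / d ≤ 0 := by
    have : 1 / p ≤ σ / d := by
      rw [div_le_div_iff₀ hp' hd']
      rw [div_lt_iff₀ hp'] at hσ
      linarith
    linarith
  have hbddφ : BddAbove (Set.range φ) :=
    ⟨C, by rintro _ ⟨x, rfl⟩; exact (le_abs_self _).trans (hbd x)⟩
  set M := amp d j L σ p * ⨆ x, φ x with hM
  have hMpos : 0 < M := mul_pos hA hpos
  let K := Fin d → Fin (2 ^ j)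
  let em : K → Fin d → ℕ := fun k i => (k i : ℕ)
  have hem : ∀ k i, em k i < 2 ^ j := fun k i => (k i).2
  have heminj : ∀ k k', em k = em k' → k = k' := fun k k' h => by
    funext i; exact Fin.ext (congrFun h i)
  haveI : Nonempty K := ⟨fun _ => ⟨0, by positivity⟩⟩
  have hfle : ∀ l x, bumpFn d j L σ p φ l x ≤ M := fun l x => by
    rw [bumpFn_eq]
    exact mul_le_mul_of_nonneg_left (le_ciSup hbddφ _) hA.le
  have hmain : ∃ k : K, M / 2 ≤ ∫ ω, ((⨆ x ∈ Set.Icc (0 : Fin d → ℝ) 1,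
      bumpFn d j L σ p φ (em k) x) - bumpFn d j L σ p φ (em k) (Q (em k) (T - 1) ω)) ∂P := by
    apply abstract_avg P (fun (k : K) ω => (⨆ x ∈ Set.Icc (0 : Fin d → ℝ) 1,
      bumpFn d j L σ p φ (em k) x) - bumpFn d j L σ p φ (em k) (Q (em k) (T - 1) ω))
    · intro k
      refine (integrable_const _).sub ?_
      refine Integrable.of_bound (hmeas _ _).aestronglyMeasurable (amp d j L σ p * C) ?_
      refine Filter.Eventually.of_forall fun ω => ?_
      rw [bumpFn_eq, Real.norm_eq_abs, abs_mul, abs_of_pos hA]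
      exact mul_le_mul_of_nonneg_left (hbd _) hA.le
    · intro ω
      let z : ℕ → (Fin d → ℝ) := zeroSeq (fun t xs => xhat t ω xs (fun _ => 0))
      let B : Finset K := (Finset.range T).biUnion fun s =>
        Finset.univ.filter fun k => bumpFn d j L σ p φ (em k) (z s) ≠ 0
      have hB : B.card ≤ T := by
        have := Finset.card_biUnion_le_card_mul (Finset.range T) (fun s =>
          Finset.univ.filter fun k : K => bumpFn d j L σ p φ (em k) (z s) ≠ 0) 1 (by
            intro s _
            rw [Finset.card_le_one]
            intro a ha b hb
            simp only [Finset.mem_filter, Finset.mem_univ, true_and] at ha hb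
            exact heminj _ _ (bump_disjoint d j L σ p φ hsupp _ _ _ ha hb))
        simpa using this
      have hterm : ∀ k : K, (M - if k ∈ B then M else 0) ≤ (⨆ x ∈ Set.Icc (0 : Fin d → ℝ) 1,
          bumpFn d j L σ p φ (em k) x) - bumpFn d j L σ p φ (em k) (Q (em k) (T - 1) ω) := by
        intro k
        have hs := sup_ge d j L σ p φ C hbd hsupp hpos hA (em k) (hem k)
        refine sub_le_sub hs ?_
        split_ifs with hk
        · exact hfle _ _
        · have hz : ∀ s < T, bumpFn d j L σ p φ (em k) (z s) = 0 := by
            intro s hs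
            by_contra hne
            exact hk (Finset.mem_biUnion.2 ⟨s, Finset.mem_range.2 hs, by simpa using hne⟩)
          have := follow_zero (fun t => xhat t ω) (bumpFn d j L σ p φ (em k))
            (fun t => Q (em k) t ω) (fun t => hrec (em k) (hem k) t ω) T hz (T - 1) (by omega)
          rw [this]
          exact (hz (T - 1) (by omega)).le
      refine le_trans ?_ (Finset.sum_le_sum fun k _ => hterm k)
      rw [Finset.sum_sub_distrib, Finset.sum_ite_mem, Finset.univ_inter]
      simp only [Finset.sum_const, nsmul_eq_mul, Finset.card_univ]
      have hcard : 2 * T ≤ Fintype.card K := by simpa [K] using hN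
      have h1 : (2 : ℝ) * T ≤ Fintype.card K := by exact_mod_cast hcard
      have h2 : (B.card : ℝ) ≤ T := by exact_mod_cast hB
      nlinarith
  obtain ⟨k, hk⟩ := hmain
  refine ⟨em k, hem k, le_trans ?_ hk⟩
  have hpow : (2 : ℝ) ^ (((d : ℝ) + 1) * (1 / p - σ / d)) * (T : ℝ) ^ ((1 : ℝ) / p - σ / d)
      ≤ (2 : ℝ) ^ (((d : ℝ) * j) * (1 / p - σ / d)) := by
    rw [Real.rpow_mul (by norm_num), Real.rpow_mul (by norm_num),
      ← Real.mul_rpow (by positivity) (by positivity)]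
    exact Real.rpow_le_rpow_of_nonpos (by positivity) hup hexp
  have hhalf : (2 : ℝ) ^ (-((d : ℝ) + 1)) ≤ 1 / 2 := by
    calc (2 : ℝ) ^ (-((d : ℝ) + 1)) ≤ 2 ^ (-1 : ℝ) :=
          Real.rpow_le_rpow_of_exponent_le (by norm_num) (by linarith)
      _ = 1 / 2 := by rw [Real.rpow_neg_one]; norm_num
  have hS := hpos
  rw [hM, amp_eq d j hd]
  set S := ⨆ x, φ x
  calc _ = (2 : ℝ) ^ (-((d : ℝ) + 1)) * ((L * S) * ((2 : ℝ) ^ (((d : ℝ) + 1) * (1 / p - σ / d))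
          * (T : ℝ) ^ ((1 : ℝ) / p - σ / d))) := by ring
    _ ≤ (1 / 2) * ((L * S) * (2 : ℝ) ^ (((d : ℝ) * j) * (1 / p - σ / d))) := by
        gcongr
    _ = _ := by ring
end
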